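/- For m ≥ 4 and d ≥ 9, the family of points of border rank 5 in ℙ^r (r = C(m+d,m)-1) whose unique evincing degree-5 scheme is curvilinear of combinatorial type (s; b₁,…,b_s) is irreducible of dimension 5m + s - 1. -/

import Mathlib

open MvPolynomial

/-- A linear form on `k^{m+1}` with coefficient vector `a`. -/
noncomputable def linF {k : Type*} [Field k] {n : ℕ} (a : Fin n → k) : MvPolynomial (Fin n) k :=
  ∑ i, MvPolynomial.C (a i) * MvPolynomial.X i

/-- Veronese image of a parametrized curvilinear branch, as a polynomial in the parameter:
the span of coefficients `0, …, c-1` is `⟨ν_d(A[c])⟩`. -/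
noncomputable def veroneseJet {k : Type*} [Field k] {n t : ℕ} (w : Fin t → (Fin n → k))
    (d : ℕ) : Polynomial (MvPolynomial (Fin n) k) :=
  (∑ j : Fin t, Polynomial.C (linF (w j)) * Polynomial.X ^ (j : ℕ)) ^ d

/-- The ideal of polynomial functions (in the coefficients of a degree-`d` form, i.e. in
variables indexed by monomial exponents) vanishing on a set `S` of forms: the homogeneous
ideal of the affine cone over the corresponding family of points of `ℙ^r`. -/
noncomputable def vanishingIdealOfFamily {k : Type*} [Field k] {n : ℕ}
    (S : Set (MvPolynomial (Fin n) k)) : Ideal (MvPolynomial ((Fin n) →₀ ℕ) k) :=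
  ⨅ F ∈ S, RingHom.ker (MvPolynomial.eval fun σ : (Fin n) →₀ ℕ => MvPolynomial.coeff σ F)


theorem aux_krull_integral {A B : Type*} [CommRing A] [CommRing B] [Algebra A B]
    [Algebra.IsIntegral A B] [FaithfulSMul A B] : ringKrullDim B = ringKrullDim A := by
  apply le_antisymm
  · refine Order.krullDim_le_of_strictMono (PrimeSpectrum.comap (algebraMap A B)) ?_
    intro p q h
    exact Ideal.IsIntegral.comap_lt_comap (R := A) (I := p.asIdeal) (J := q.asIdeal) h
  · refine iSup_le fun l => ?_
    obtain ⟨⟨P, hP, hP'⟩⟩ := Ideal.nonempty_primesOver (S := B) (RelSeries.head l).asIdeal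
    obtain ⟨L, hL, -⟩ := Ideal.exists_ltSeries_of_hasGoingUp l P
    rw [← hL]
    exact le_iSup (fun p : LTSeries (PrimeSpectrum B) => ((p.length : ℕ∞) : WithBot ℕ∞)) L

theorem aux_krull_trdeg {k B : Type u} [Field k] [CommRing B] [IsDomain B] [Algebra k B]
    [Algebra.FiniteType k B] (N : ℕ) (h : Algebra.trdeg k B = N) : ringKrullDim B = N := by
  obtain ⟨n, g, hg, hi⟩ := exists_integral_inj_algHom_of_fg k B
  let _ := g.toRingHom.toAlgebra
  have : IsScalarTower k (MvPolynomial (Fin n) k) B := IsScalarTower.of_algHom g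
  have : Algebra.IsIntegral (MvPolynomial (Fin n) k) B := ⟨hi⟩
  have : FaithfulSMul (MvPolynomial (Fin n) k) B :=
    (faithfulSMul_iff_algebraMap_injective _ _).mpr hg
  have h1 := trdeg_add_eq (R := k) (S := MvPolynomial (Fin n) k) (A := B)
  rw [h, trdeg_eq_zero (R := MvPolynomial (Fin n) k), MvPolynomial.trdeg_of_isDomain] at h1
  have h2 : n = N := by
    simp at h1
    exact_mod_cast h1
  rw [aux_krull_integral (A := MvPolynomial (Fin n) k),
    MvPolynomial.ringKrullDim_of_isNoetherianRing, h2]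
  simp

/-- Jacobian criterion. -/
theorem aux_jacobian {k τ ι : Type*} [Field k] [CharZero k] [Fintype ι] [DecidableEq ι] (f : ι → MvPolynomial τ k) (e : ι → τ)
    (hJ : (Matrix.of fun i j => pderiv (e j) (f i)).det ≠ 0) :
    AlgebraicIndependent k f := by
  rw [algebraicIndependent_iff]
  suffices H : ∀ n : ℕ, ∀ p : MvPolynomial ι k, p.totalDegree ≤ n → aeval f p = 0 → p = 0 from
    fun p hp => H _ p le_rfl hp
  intro n
  induction n with
  | zero =>
    intro p hp h0
    rw [Nat.le_zero, totalDegree_eq_zero_iff_eq_C] at hp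
    rw [hp] at h0 ⊢
    rw [aeval_C, MvPolynomial.algebraMap_eq] at h0
    rw [C_eq_zero] at h0
    rw [h0, C_0]
  | succ n ih =>
    intro p hp h0
    have hchain : ∀ t : τ, ∀ q : MvPolynomial ι k, pderiv t (aeval f q) = ∑ i, aeval f (pderiv i q) * pderiv t (f i) := by
      intro t q
      induction q using MvPolynomial.induction_on with
      | C a => simp
      | add p q hp hq => simp only [map_add, hp, hq, add_mul, Finset.sum_add_distrib]
      | mul_X p j hp =>
        simp only [map_mul, aeval_X, pderiv_mul, hp, map_add, add_mul, Finset.sum_add_distrib, pderiv_X]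
        congr 1
        · rw [Finset.sum_mul]
          exact Finset.sum_congr rfl fun i _ => by ring
        · rw [Finset.sum_eq_single j]
          · simp
          · intro b _ hb
            simp [hb.symm]
          · simp
    have h1 : Matrix.vecMul (fun i => aeval f (pderiv i p)) (Matrix.of fun i j => pderiv (e j) (f i)) = 0 := by
      ext1 j
      have := hchain (e j) p
      rw [h0, map_zero] at this
      exact this.symm
    have h2 := Matrix.eq_zero_of_vecMul_eq_zero hJ h1
    have h3 : ∀ i, pderiv i p = 0 := by
      intro i
      refine ih _ ?_ (congrFun h2 i)
      refine Finset.sup_le fun m hm => ?_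
      rw [mem_support_iff, coeff_pderiv] at hm
      have h5 := le_totalDegree (mem_support_iff.mpr (left_ne_zero_of_mul hm))
      have h6 : ((m + Finsupp.single i 1).sum fun _ e => e) = (m.sum fun _ e => e) + 1 := by
        rw [Finsupp.sum_add_index' (by simp) (by simp)]
        simp
      omega
    have h4 : p.totalDegree = 0 := by
      rw [totalDegree_eq_zero_iff]
      intro m hm i
      by_contra hmi
      have := congrArg (coeff (m - Finsupp.single i 1)) (h3 i)
      rw [coeff_pderiv] at this
      have e1 : m - Finsupp.single i 1 + Finsupp.single i 1 = m :=
        tsub_add_cancel_of_le (by simpa [Finsupp.single_le_iff, Nat.one_le_iff_ne_zero] using hmi)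
      rw [e1, coeff_zero] at this
      rcases mul_eq_zero.mp this with h | h
      · exact (mem_support_iff.mp hm) h
      · exact Nat.cast_add_one_ne_zero _ h
    rw [totalDegree_eq_zero_iff_eq_C] at h4
    rw [h4] at h0 ⊢
    rw [aeval_C, MvPolynomial.algebraMap_eq, C_eq_zero] at h0
    rw [h0, C_0]

theorem aux_expand {k : Type*} [Field k] [CharZero k] (B D : ℕ) (x W : Polynomial k)
    (h : ∀ u : k, u * ((1 + Polynomial.C u * x) ^ D * W).coeff B = 0) (r : ℕ) (hr : r ≤ D) :
    (x ^ r * W).coeff B = 0 := by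
  have h1 : (Polynomial.X * ∑ r ∈ Finset.range (D + 1),
      Polynomial.monomial r ((D.choose r : k) * (x ^ r * W).coeff B) : Polynomial k) = 0 := by
    apply Polynomial.funext
    intro u
    rw [Polynomial.eval_mul, Polynomial.eval_X, Polynomial.eval_zero, ← h u]
    congr 1
    rw [add_comm 1 (Polynomial.C u * x), add_pow, Finset.sum_mul, Polynomial.finsetSum_coeff, Polynomial.eval_finsetSum]
    refine Finset.sum_congr rfl fun r _ => ?_
    rw [Polynomial.eval_monomial, one_pow, mul_one, mul_pow, ← Polynomial.C_pow,
      show Polynomial.C (u ^ r) * x ^ r * (D.choose r : Polynomial k) * W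
        = Polynomial.C (u ^ r) * (Polynomial.C (D.choose r : k) * (x ^ r * W)) by simp; ring,
      Polynomial.coeff_C_mul, Polynomial.coeff_C_mul]
    ring
  have h2 := (mul_eq_zero.mp h1).resolve_left Polynomial.X_ne_zero
  have h3 := congrArg (fun p => Polynomial.coeff p r) h2
  simp only [Polynomial.finsetSum_coeff, Polynomial.coeff_monomial, Polynomial.coeff_zero] at h3
  rw [Finset.sum_ite_eq' , if_pos (by simp; omega)] at h3
  exact (mul_eq_zero.mp h3).resolve_left (by exact_mod_cast (Nat.choose_pos hr).ne')

theorem aux_nondeg {k : Type*} [Field k] (b : ℕ) (p : Polynomial k)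
    (h : ∀ y : Polynomial k, (y * p).coeff (b - 1) = 0) (j : ℕ) (hj : j < b) : p.coeff j = 0 := by
  have := h (Polynomial.X ^ (b - 1 - j))
  rwa [show b - 1 = j + (b - 1 - j) by omega, show j + (b - 1 - j) - j = b - 1 - j by omega,
    Polynomial.coeff_X_pow_mul] at this

theorem aux_tangent {k : Type*} [Field k] [CharZero k] (b D : ℕ) (hD : 2 ≤ D)
    (w : Polynomial k →ₗ[k] Polynomial k) (hw : ∀ x j, b ≤ j → (w x).coeff j = 0)
    (hw1 : ∀ j, j ≠ b - 1 → (w 1).coeff j = 0)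
    (h : ∀ x : Polynomial k, (x ^ D * w x).coeff (b - 1) = 0) (r : ℕ) :
    w (Polynomial.X ^ r) = 0 := by
  have w1 : w 1 = 0 := by
    ext j
    by_cases hj : j = b - 1
    · have := h 1
      simpa [hj] using this
    · simpa using hw1 j hj
  have hexp : ∀ x : Polynomial k, ∀ r ≤ D, (x ^ r * w x).coeff (b - 1) = 0 := by
    intro x r hr
    refine aux_expand (b - 1) D x (w x) (fun u => ?_) r hr
    have := h (1 + Polynomial.C u * x)
    rwa [map_add, w1, zero_add, Polynomial.C_mul', map_smul, ← Polynomial.C_mul',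
      mul_smul_comm, Polynomial.coeff_smul, smul_eq_mul] at this
  have e0 : ∀ x, (w x).coeff (b - 1) = 0 := fun x => by simpa using hexp x 0 (by omega)
  have e1 : ∀ x y, (y * w x).coeff (b - 1) = - (x * w y).coeff (b - 1) := by
    intro x y
    have h1 := hexp (x + y) 1 (by omega)
    have h2 := hexp x 1 (by omega)
    have h3 := hexp y 1 (by omega)
    simp only [pow_one, map_add, add_mul, mul_add, Polynomial.coeff_add] at h1 h2 h3
    linear_combination h1 - h2 - h3
  have e2 : ∀ x y, (x ^ 2 * w y + 2 * (x * y * w x)).coeff (b - 1) = 0 := by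
    intro x y
    have h1 := hexp (x + y) 2 (by omega)
    have h2 := hexp (x - y) 2 (by omega)
    have h3 := hexp y 2 (by omega)
    have h4 : (2 * (x ^ 2 * w y + 2 * (x * y * w x))) =
      (x + y) ^ 2 * w (x + y) - (x - y) ^ 2 * w (x - y) - 2 * (y ^ 2 * w y) := by
      rw [map_add, map_sub]; ring
    have h5 := congrArg (fun p => Polynomial.coeff p (b - 1)) h4
    simp only [Polynomial.coeff_sub, h1, h2, Polynomial.coeff_ofNat_mul, h3] at h5
    simpa using h5
  have e3 : ∀ x j, j < b → (w (x ^ 2)).coeff j = (2 * (x * w x)).coeff j := by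
    intro x j hj
    rw [← sub_eq_zero, ← Polynomial.coeff_sub]
    refine aux_nondeg b _ (fun y => ?_) j hj
    have h1 := e1 (x ^ 2) y
    have h2 := e2 x y
    rw [mul_sub, Polynomial.coeff_sub, h1, show y * (2 * (x * w x)) = 2 * (x * y * w x) by ring]
    rw [Polynomial.coeff_add] at h2
    linear_combination -h2
  have e4 : ∀ x y j, j < b → (w (x * y)).coeff j = (x * w y + y * w x).coeff j := by
    intro x y j hj
    have h1 := e3 (x + y) j hj
    have h2 := e3 x j hj
    have h3 := e3 y j hj
    have h4 : (x + y) ^ 2 = x ^ 2 + y ^ 2 + (2 : k) • (x * y) := by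
      rw [Polynomial.smul_eq_C_mul, Polynomial.C_ofNat]; ring
    rw [h4, map_add, map_add, map_smul, map_add,
      show 2 * ((x + y) * (w x + w y)) = 2 * (x * w x) + 2 * (y * w y) + 2 * (x * w y + y * w x) by ring]
      at h1
    simp only [Polynomial.coeff_add, Polynomial.coeff_smul, smul_eq_mul] at h1 h2 h3 ⊢
    rw [h2, h3, Polynomial.coeff_ofNat_mul (a := 2) (p := x * w y + y * w x), Polynomial.coeff_add] at h1
    have h5 : (2 : k) ≠ 0 := two_ne_zero
    apply mul_left_cancel₀ h5
    simpa using h1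
  have e5 : ∀ r j, j < b → (w (Polynomial.X ^ (r + 1))).coeff j =
      (((r + 1 : ℕ) : Polynomial k) * (Polynomial.X ^ r * w Polynomial.X)).coeff j := by
    intro r
    induction r with
    | zero => intro j _; simp
    | succ r ih =>
      intro j hj
      rw [pow_succ', e4 _ _ j hj]
      have : (Polynomial.X * w (Polynomial.X ^ (r + 1))).coeff j =
        (Polynomial.X * (((r + 1 : ℕ) : Polynomial k) * (Polynomial.X ^ r * w Polynomial.X))).coeff j := by
        cases j with
        | zero => simp
        | succ j => rw [Polynomial.coeff_X_mul, Polynomial.coeff_X_mul, ih j (by omega)]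
      rw [Polynomial.coeff_add, this, ← Polynomial.coeff_add]
      congr 1
      push_cast
      ring
  have wX : ∀ j < b, (w Polynomial.X).coeff j = 0 := by
    intro j hj
    have h1 := e0 (Polynomial.X ^ (b - 1 - j + 1))
    rw [e5 _ _ (by omega), Polynomial.coeff_natCast_mul] at h1
    have h2 := (mul_eq_zero.mp h1).resolve_left (Nat.cast_ne_zero.mpr (by omega))
    rwa [Polynomial.coeff_X_pow_mul', if_pos (by omega),
      show b - 1 - (b - 1 - j) = j by omega] at h2
  cases r with
  | zero => simpa using w1
  | succ r =>
    ext j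
    by_cases hj : j < b
    · rw [e5 _ _ hj, Polynomial.coeff_zero, Polynomial.coeff_natCast_mul, Polynomial.coeff_X_pow_mul']
      split_ifs
      · rw [wX _ (by omega), mul_zero]
      · simp
    · simpa using hw _ j (by omega)

noncomputable def linA {A : Type*} [CommRing A] {n : ℕ} (a : Fin n → A) : MvPolynomial (Fin n) A :=
  ∑ i, MvPolynomial.C (a i) * MvPolynomial.X i

noncomputable def jetA {A : Type*} [CommRing A] {n t : ℕ} (w : Fin t → (Fin n → A)) :
    Polynomial (MvPolynomial (Fin n) A) :=
  ∑ j : Fin t, Polynomial.C (linA (w j)) * Polynomial.X ^ (j : ℕ)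

/-- every polynomial is a polynomial in a uniformizer `y` modulo `X ^ b` -/
theorem aux_rep {K : Type*} [Field K] (y : Polynomial K) (hy0 : y.coeff 0 = 0) (b : ℕ)
    (hy1 : 2 ≤ b → y.coeff 1 ≠ 0) (f : Polynomial K) :
    ∃ q : ℕ → K, (Polynomial.X ^ b) ∣ (f - ∑ j ∈ Finset.range b, Polynomial.C (q j) * y ^ j) := by
  induction b with
  | zero => exact ⟨0, by simp⟩
  | succ b ih =>
    obtain ⟨q, hq⟩ := ih (fun h => hy1 (by omega))
    obtain ⟨z, hz⟩ := Polynomial.X_dvd_iff.mpr hy0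
    obtain ⟨r, hr⟩ := hq
    have hz0 : b = 0 ∨ z.coeff 0 ≠ 0 := by
      rcases Nat.eq_zero_or_pos b with h | h
      · exact Or.inl h
      · right
        have := hy1 (by omega)
        rwa [hz, Polynomial.coeff_X_mul] at this
    have hzb : (z ^ b).coeff 0 ≠ 0 := by
      rw [Polynomial.coeff_zero_eq_eval_zero, Polynomial.eval_pow, ← Polynomial.coeff_zero_eq_eval_zero]
      rcases hz0 with h | h
      · simp [h]
      · exact pow_ne_zero _ h
    refine ⟨Function.update q b (r.coeff 0 / (z ^ b).coeff 0), ?_⟩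
    rw [Finset.sum_range_succ, Function.update_self]
    have h1 : ∑ j ∈ Finset.range b, Polynomial.C (Function.update q b (r.coeff 0 / (z ^ b).coeff 0) j) * y ^ j
      = ∑ j ∈ Finset.range b, Polynomial.C (q j) * y ^ j := by
      refine Finset.sum_congr rfl fun j hj => ?_
      rw [Function.update_of_ne (by simp at hj; omega)]
    rw [h1, ← sub_sub, hr, hz, mul_pow, pow_succ,
      show Polynomial.X ^ b * r - Polynomial.C (r.coeff 0 / (z ^ b).coeff 0) * (Polynomial.X ^ b * z ^ b)
        = Polynomial.X ^ b * (r - Polynomial.C (r.coeff 0 / (z ^ b).coeff 0) * z ^ b) by ring]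
    apply mul_dvd_mul_left
    rw [Polynomial.X_dvd_iff, Polynomial.coeff_sub, Polynomial.coeff_C_mul, div_mul_cancel₀ _ hzb, sub_self]

/-- coordinate polynomial of a jet -/
noncomputable def coordA {A : Type*} [CommRing A] {n t : ℕ} (w : Fin t → (Fin n → A)) (l : Fin n) :
    Polynomial A := ∑ j : Fin t, Polynomial.C (w j l) * Polynomial.X ^ (j : ℕ)

theorem jetA_eq {A : Type*} [CommRing A] {n t : ℕ} (w : Fin t → (Fin n → A)) :
    jetA w = ∑ l, (coordA w l).map MvPolynomial.C * Polynomial.C (MvPolynomial.X l) := by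
  simp only [jetA, coordA, linA, Polynomial.map_sum, Polynomial.map_mul, Polynomial.map_C,
    Polynomial.map_pow, Polynomial.map_X, map_sum, Finset.sum_mul, map_mul]
  rw [Finset.sum_comm]
  refine Finset.sum_congr rfl fun l _ => Finset.sum_congr rfl fun j _ => by ring

theorem coordA_coeff {A : Type*} [CommRing A] {n t : ℕ} (w : Fin t → (Fin n → A)) (l : Fin n)
    (j : Fin t) : (coordA w l).coeff j = w j l := by
  simp only [coordA, Polynomial.finsetSum_coeff, Polynomial.coeff_C_mul, Polynomial.coeff_X_pow]
  rw [Finset.sum_eq_single j]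
  · simp
  · intro i _ hi
    have : (j : ℕ) ≠ i := fun h => hi (Fin.ext h.symm)
    simp [this]
  · simp

theorem coordA_coeff_ge {A : Type*} [CommRing A] {n t : ℕ} (w : Fin t → (Fin n → A)) (l : Fin n)
    (j : ℕ) (hj : t ≤ j) : (coordA w l).coeff j = 0 := by
  simp only [coordA, Polynomial.finsetSum_coeff, Polynomial.coeff_C_mul, Polynomial.coeff_X_pow]
  refine Finset.sum_eq_zero fun i _ => ?_
  rw [if_neg (by omega), mul_zero]

theorem aux_reparam {K : Type*} [Field K] {n b : ℕ} (d : ℕ) (v Q : Fin b → Fin n → K)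
    (u y : Polynomial K) (hy0 : y.coeff 0 = 0)
    (h : ∀ l, Polynomial.X ^ b ∣ coordA v l - u * (coordA Q l).comp y) (i : Fin b) :
    (jetA v ^ d).coeff i = ∑ j : Fin b, MvPolynomial.C ((u ^ d * y ^ (j : ℕ)).coeff i) * (jetA Q ^ d).coeff j := by
  set U : Polynomial (MvPolynomial (Fin n) K) := u.map MvPolynomial.C with hU
  set Y : Polynomial (MvPolynomial (Fin n) K) := y.map MvPolynomial.C with hY
  have h1 : Polynomial.X ^ b ∣ jetA v - U * (jetA Q).comp Y := by
    rw [jetA_eq, jetA_eq, Polynomial.sum_comp, Finset.mul_sum, ← Finset.sum_sub_distrib]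
    refine Finset.dvd_sum fun l _ => ?_
    rw [Polynomial.mul_comp, Polynomial.C_comp, ← mul_assoc, ← sub_mul]
    apply Dvd.dvd.mul_right
    have := map_dvd (Polynomial.mapRingHom (MvPolynomial.C (σ := Fin n) (R := K))) (h l)
    simpa [Polynomial.map_comp] using this
  have h2 : Polynomial.X ^ b ∣ jetA v ^ d - (U * (jetA Q).comp Y) ^ d :=
    h1.trans (sub_dvd_pow_sub_pow _ _ _)
  rw [mul_pow, ← Polynomial.pow_comp] at h2
  set G := jetA Q ^ d with hG
  have h3 : Polynomial.X ^ b ∣ G.comp Y - ∑ j : Fin b, Polynomial.C (G.coeff j) * Y ^ (j : ℕ) := by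
    have hYX : Polynomial.X ∣ Y := by
      rw [Polynomial.X_dvd_iff, hY, Polynomial.coeff_map, hy0, map_zero]
    rw [Polynomial.comp, Polynomial.eval₂_eq_sum_range' Polynomial.C (n := b + (G.natDegree + 1)) (by omega),
      Finset.sum_range_add, Finset.sum_range (n := b), add_sub_cancel_left]
    refine Finset.dvd_sum fun j _ => ?_
    exact ((pow_dvd_pow_of_dvd hYX b).trans (pow_dvd_pow _ (by omega))).mul_left _
  have h4 : Polynomial.X ^ b ∣ jetA v ^ d - U ^ d * ∑ j : Fin b, Polynomial.C (G.coeff j) * Y ^ (j : ℕ) := by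
    have := dvd_add h2 (h3.mul_left (U ^ d))
    rwa [mul_sub, sub_add_sub_cancel] at this
  rw [Polynomial.X_pow_dvd_iff] at h4
  have h5 := h4 i i.2
  rw [Polynomial.coeff_sub, sub_eq_zero] at h5
  rw [h5, Finset.mul_sum, Polynomial.finsetSum_coeff]
  refine Finset.sum_congr rfl fun j _ => ?_
  rw [mul_left_comm, Polynomial.coeff_C_mul, hU, hY, ← Polynomial.map_pow, ← Polynomial.map_pow,
    ← Polynomial.map_mul, Polynomial.coeff_map, mul_comm]

theorem coordA_comp {K : Type*} [Field K] {n b : ℕ} (Q : Fin b → Fin n → K) (l : Fin n) (y : Polynomial K) :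
    (coordA Q l).comp y = ∑ j : Fin b, Polynomial.C (Q j l) * y ^ (j : ℕ) := by
  simp [coordA, Polynomial.sum_comp]

theorem aux_slice {K : Type*} [Field K] {m b : ℕ} (hb : 1 ≤ b) (d : ℕ) (v : Fin b → Fin (m + 2) → K)
    (h0 : v ⟨0, hb⟩ 0 ≠ 0)
    (h1 : ∀ h : 2 ≤ b, v ⟨0, hb⟩ 0 * v ⟨1, h⟩ 1 - v ⟨1, h⟩ 0 * v ⟨0, hb⟩ 1 ≠ 0) (a : Fin b → K) :
    ∃ (c : K) (z : Fin b → Fin (m + 1) → K),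
      ∑ j : Fin b, MvPolynomial.C (a j) * (jetA v ^ d).coeff j =
      ∑ j : Fin b, MvPolynomial.C (z j 0) * (jetA (fun j : Fin b =>
        (Fin.cons (if (j : ℕ) = 0 then 1 else 0) (fun l : Fin (m + 1) => if l = 0 then
          (if (j : ℕ) = 0 then c else if (j : ℕ) = 1 then 1 else 0) else z j l) : Fin (m + 2) → K)) ^ d).coeff j := by
  set u := coordA v 0 with hu
  have hu0 : u.coeff 0 ≠ 0 := by
    have := coordA_coeff v 0 ⟨0, hb⟩
    simp only at this
    rw [hu, this]; exact h0
  have hcop : IsCoprime u (Polynomial.X ^ b) := by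
    apply IsCoprime.pow_right
    rw [isCoprime_comm]
    refine (Polynomial.irreducible_X.coprime_iff_not_dvd).mpr ?_
    rwa [Polynomial.X_dvd_iff]
  obtain ⟨u', r, hur⟩ := hcop
  set f : Fin (m + 2) → Polynomial K := fun l => u' * coordA v l with hf
  have hfu : ∀ l, Polynomial.X ^ b ∣ coordA v l - u * f l := by
    intro l
    refine ⟨r * coordA v l, ?_⟩
    rw [hf]
    linear_combination (-coordA v l) * hur
  set c := (f 1).coeff 0
  set y := f 1 - Polynomial.C c with hy
  have hy0 : y.coeff 0 = 0 := by simp [hy, c]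
  have hy1 : 2 ≤ b → y.coeff 1 ≠ 0 := by
    intro h2 hc
    have e := (Polynomial.X_pow_dvd_iff.mp (hfu 1))
    have e0 := e 0 (by omega)
    have e1 := e 1 (by omega)
    have hf1 : (f 1).coeff 1 = 0 := by
      simpa [hy, Polynomial.coeff_C] using hc
    rw [Polynomial.coeff_sub, Polynomial.mul_coeff_zero] at e0
    rw [Polynomial.coeff_sub, Polynomial.mul_coeff_one, hf1] at e1
    have v00 : u.coeff 0 = v ⟨0, hb⟩ 0 := coordA_coeff v 0 ⟨0, hb⟩
    have v10 : u.coeff 1 = v ⟨1, h2⟩ 0 := coordA_coeff v 0 ⟨1, h2⟩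
    have v01 : (coordA v 1).coeff 0 = v ⟨0, hb⟩ 1 := coordA_coeff v 1 ⟨0, hb⟩
    have v11 : (coordA v 1).coeff 1 = v ⟨1, h2⟩ 1 := coordA_coeff v 1 ⟨1, h2⟩
    rw [v00, v01] at e0
    rw [v00, v10, v11] at e1
    apply h1 h2
    linear_combination (v ⟨0, hb⟩ 0) * e1 - (v ⟨1, h2⟩ 0) * e0
  choose q hq using fun l => aux_rep y hy0 b hy1 (f l)
  set z : Fin b → Fin (m + 1) → K := fun j l => if l = 0 then
    ∑ i : Fin b, a i * (u ^ d * y ^ (j : ℕ)).coeff i else q l.succ j with hz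
  refine ⟨c, z, ?_⟩
  set Q : Fin b → Fin (m + 2) → K := fun j : Fin b =>
        (Fin.cons (if (j : ℕ) = 0 then 1 else 0) (fun l : Fin (m + 1) => if l = 0 then
          (if (j : ℕ) = 0 then c else if (j : ℕ) = 1 then 1 else 0) else z j l) : Fin (m + 2) → K) with hQ
  have key : ∀ l, Polynomial.X ^ b ∣ coordA v l - u * (coordA Q l).comp y := by
    intro l
    suffices H : Polynomial.X ^ b ∣ f l - (coordA Q l).comp y by
      have := dvd_add (hfu l) (H.mul_left u)
      rwa [mul_sub, sub_add_sub_cancel] at this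
    rw [coordA_comp]
    refine Fin.cases ?_ (fun l => ?_) l
    · have : ∑ j : Fin b, Polynomial.C (Q j 0) * y ^ (j : ℕ) = 1 := by
        rw [Finset.sum_eq_single ⟨0, hb⟩]
        · simp [hQ]
        · intro j _ hj
          have : (j : ℕ) ≠ 0 := fun h => hj (Fin.ext h)
          simp [hQ, this]
        · simp
      rw [this]
      exact ⟨-r, by rw [hf]; linear_combination hur⟩
    · by_cases hl : l = 0
      · subst hl
        obtain ⟨b', rfl⟩ : ∃ b', b = b' + 1 := ⟨b - 1, by omega⟩
        cases b' with
        | zero =>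
          have : f 1 - ∑ j : Fin 1, Polynomial.C (Q j (Fin.succ 0)) * y ^ (j : ℕ) = y := by
            simp [hQ, hy]
          rw [show (Fin.succ 0 : Fin (m + 2)) = 1 from rfl] at this ⊢
          rw [this, zero_add, pow_one, Polynomial.X_dvd_iff, hy0]
        | succ b' =>
          have : f 1 - ∑ j : Fin (b' + 1 + 1), Polynomial.C (Q j (Fin.succ 0)) * y ^ (j : ℕ) = 0 := by
            rw [Fin.sum_univ_succ, Fin.sum_univ_succ, Finset.sum_eq_zero]
            · simp [hQ, hy]
            · intro i _
              simp [hQ]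
          rw [show (Fin.succ 0 : Fin (m + 2)) = 1 from rfl] at this ⊢
          rw [this]
          exact dvd_zero _
      · have : ∑ j : Fin b, Polynomial.C (Q j l.succ) * y ^ (j : ℕ) =
            ∑ j ∈ Finset.range b, Polynomial.C (q l.succ j) * y ^ j := by
          rw [Finset.sum_range]
          refine Finset.sum_congr rfl fun j _ => ?_
          simp [hQ, hz, hl]
        rw [this]
        exact hq _
  simp_rw [aux_reparam d v Q u y hy0 key, Finset.mul_sum]
  rw [Finset.sum_comm]
  refine Finset.sum_congr rfl fun j _ => ?_
  simp only [hz, if_true, map_sum, map_mul, Finset.sum_mul]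
  refine Finset.sum_congr rfl fun i _ => ?_
  ring


noncomputable def famA {A : Type*} [CommRing A] {n s : ℕ} (b : Fin s → ℕ) (d : ℕ)
    (v : (i : Fin s) → Fin (b i) → Fin n → A) (a : (i : Fin s) → Fin (b i) → A) :
    MvPolynomial (Fin n) A :=
  ∑ i, ∑ j : Fin (b i), MvPolynomial.C (a i j) * (jetA (v i) ^ d).coeff j

theorem jetA_map {A A' : Type*} [CommRing A] [CommRing A'] (f : A →+* A') {n t : ℕ}
    (w : Fin t → Fin n → A) :
    (jetA w).map (MvPolynomial.map f) = jetA (fun j l => f (w j l)) := by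
  simp [jetA, linA, Polynomial.map_sum]

theorem famA_map {A A' : Type*} [CommRing A] [CommRing A'] (f : A →+* A') {n s : ℕ} (b : Fin s → ℕ)
    (d : ℕ) (v : (i : Fin s) → Fin (b i) → Fin n → A) (a : (i : Fin s) → Fin (b i) → A) :
    MvPolynomial.map f (famA b d v a) = famA b d (fun i j l => f (v i j l)) (fun i j => f (a i j)) := by
  simp only [famA, map_sum, map_mul, MvPolynomial.map_C]
  refine Finset.sum_congr rfl fun i _ => Finset.sum_congr rfl fun j _ => ?_
  rw [← Polynomial.coeff_map, Polynomial.map_pow, jetA_map]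

noncomputable def PhiA (k : Type*) [Field k] {A : Type*} [CommRing A] [Algebra k A] {n s : ℕ} (b : Fin s → ℕ) (d : ℕ)
    (v : (i : Fin s) → Fin (b i) → Fin n → A) (a : (i : Fin s) → Fin (b i) → A) :
    MvPolynomial (Fin n →₀ ℕ) k →ₐ[k] A :=
  aeval fun σ => coeff σ (famA b d v a)

theorem PhiA_comp {k : Type*} [Field k] {A A' : Type*} [CommRing A] [Algebra k A] [CommRing A'] [Algebra k A']
    (f : A →ₐ[k] A') {n s : ℕ} (b : Fin s → ℕ) (d : ℕ)
    (v : (i : Fin s) → Fin (b i) → Fin n → A) (a : (i : Fin s) → Fin (b i) → A) :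
    PhiA k b d (fun i j l => f (v i j l)) (fun i j => f (a i j)) = f.comp (PhiA k b d v a) := by
  apply MvPolynomial.algHom_ext
  intro σ
  have := congrArg (coeff σ) (famA_map (f : A →+* A') b d v a)
  rw [coeff_map] at this
  simp only [PhiA, aeval_X, AlgHom.comp_apply]
  exact this.symm

theorem aux_eval_linA {k C : Type*} [Field k] [CommRing C] [Algebra k C] {n : ℕ}
    (T : (Fin n → k) →ₗ[k] C) (a : Fin n → k) :
    aeval (fun l => T (Pi.single l 1)) (linA a) = T a := by
  rw [LinearMap.pi_apply_eq_sum_univ T a]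
  simp only [linA, map_sum, map_mul, aeval_C, aeval_X, Algebra.smul_def]
  refine Finset.sum_congr rfl fun l _ => ?_
  congr 2
  ext i
  simp [Pi.single_apply, eq_comm]

theorem aux_eval_jetA {k C : Type*} [Field k] [CommRing C] [Algebra k C] {n t : ℕ}
    (T : (Fin n → k) →ₗ[k] C) (w : Fin t → Fin n → k) (d j : ℕ) :
    aeval (fun l => T (Pi.single l 1)) ((jetA w ^ d).coeff j) =
      ((∑ j : Fin t, Polynomial.C (T (w j)) * Polynomial.X ^ (j : ℕ)) ^ d).coeff j := by
  have := Polynomial.coeff_map (aeval (R := k) (fun l => T (Pi.single l 1))).toRingHom (p := jetA w ^ d) j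
  rw [AlgHom.toRingHom_eq_coe, RingHom.coe_coe] at this
  rw [← this, Polynomial.map_pow, jetA, Polynomial.map_sum]
  congr 3
  ext1 j
  rw [Polynomial.map_mul, Polynomial.map_C, Polynomial.map_pow, Polynomial.map_X, RingHom.coe_coe,
    aux_eval_linA]

theorem aux_extend {k V C ι : Type*} [Field k] [AddCommGroup V] [Module k V] [AddCommGroup C] [Module k C]
    (v : ι → V) (hv : LinearIndependent k v) (x : ι → C) : ∃ T : V →ₗ[k] C, ∀ p, T (v p) = x p := by
  obtain ⟨g, hg⟩ := LinearMap.exists_leftInverse_of_injective (Finsupp.linearCombination k v)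
    (LinearMap.ker_eq_bot.mpr hv)
  refine ⟨(Finsupp.linearCombination k x).comp g, fun p => ?_⟩
  have := congrArg (fun f => f (Finsupp.single p 1)) hg
  simp at this
  simp [this]

theorem aux_dual_pow {C : Type*} [CommRing C] (e : C) (he : e * e = 0) (x : C) (d : ℕ) :
    (x + e) ^ (d + 1) = x ^ (d + 1) + (d + 1) * (x ^ d * e) := by
  induction d with
  | zero => simp
  | succ d ih =>
    rw [pow_succ, ih]
    push_cast
    linear_combination ((d + 1) * x ^ d) * he

theorem aux_li {k : Type*} [Field k] [CharZero k] {n s : ℕ} (b : Fin s → ℕ) (hb1 : ∀ i, 1 ≤ b i) (d : ℕ) (hd : 1 ≤ d)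
    (v : (i : Fin s) → Fin (b i) → Fin n → k)
    (hv : LinearIndependent k fun p : Σ i, Fin (b i) => v p.1 p.2) :
    LinearIndependent k fun p : Σ i, Fin (b i) => (jetA (v p.1) ^ d).coeff p.2 := by
  classical
  rw [Fintype.linearIndependent_iff]
  rintro g hg ⟨i0, j0⟩
  obtain ⟨d, rfl⟩ : ∃ d', d = d' + 1 := ⟨d - 1, by omega⟩
  obtain ⟨T, hT⟩ := aux_extend _ hv (fun p : Σ i, Fin (b i) => if p.1 = i0 then
    ((if (p.2 : ℕ) = 0 then 1 else 0) + (if (p.2 : ℕ) = j0 then DualNumber.eps else 0) : DualNumber k) else 0)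
  have h1 := congrArg (fun F => TrivSqZeroExt.snd (aeval (R := k) (fun l => T (Pi.single l 1)) F)) hg
  simp only [map_sum, map_smul, aux_eval_jetA, map_zero, TrivSqZeroExt.snd_zero, TrivSqZeroExt.snd_sum,
    TrivSqZeroExt.snd_smul] at h1
  have h2 : ∑ j : Fin (b i0), Polynomial.C (T (v i0 j)) * Polynomial.X ^ (j : ℕ) =
      1 + Polynomial.C DualNumber.eps * Polynomial.X ^ (j0 : ℕ) := by
    have h3 : ∀ j, T (v i0 j) = _ := fun j => hT ⟨i0, j⟩
    simp only [h3, if_true, map_add, add_mul, Finset.sum_add_distrib]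
    congr 1
    · rw [Finset.sum_eq_single ⟨0, hb1 i0⟩]
      · simp
      · intro j _ hj
        have : (j : ℕ) ≠ 0 := fun h => hj (Fin.ext h)
        simp [this]
      · simp
    · rw [Finset.sum_eq_single j0]
      · simp
      · intro j _ hj
        have : (j : ℕ) ≠ j0 := fun h => hj (Fin.ext h)
        simp [this]
      · simp
  rw [Finset.sum_eq_single (⟨i0, j0⟩ : Σ i, Fin (b i))] at h1
  · rw [h2, aux_dual_pow] at h1
    · have h4 : ((1 : Polynomial (DualNumber k)) ^ (d + 1) +
          ((d : Polynomial (DualNumber k)) + 1) * (1 ^ d * (Polynomial.C DualNumber.eps * Polynomial.X ^ (j0 : ℕ)))).coeff (j0 : ℕ)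
          = (if (j0 : ℕ) = 0 then 1 else 0) + ((d : DualNumber k) + 1) * DualNumber.eps := by
        rw [one_pow, one_pow, one_mul, Polynomial.coeff_add, Polynomial.coeff_one, ← mul_assoc,
          Polynomial.coeff_mul_X_pow', if_pos le_rfl, Nat.sub_self]
        congr 1
        simp
      rw [h4] at h1
      have h5 : TrivSqZeroExt.snd ((if (j0 : ℕ) = 0 then (1 : DualNumber k) else 0) + ((d : DualNumber k) + 1) * DualNumber.eps) = ((d : k) + 1) := by
        rw [TrivSqZeroExt.snd_add]
        split_ifs <;> simp [TrivSqZeroExt.snd_mul]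
      rw [h5, smul_eq_mul] at h1
      exact (mul_eq_zero.mp h1).resolve_right (Nat.cast_add_one_ne_zero d)
    · rw [mul_mul_mul_comm, ← Polynomial.C_mul, DualNumber.eps_mul_eps, map_zero, zero_mul]
  · rintro ⟨i, j⟩ _ hij
    by_cases h : i = i0
    · subst h
      have hj : (j : ℕ) ≠ j0 := fun hh => hij (by rw [Fin.ext hh])
      simp only [h2]
      rw [aux_dual_pow]
      · rw [one_pow, one_pow, one_mul, Polynomial.coeff_add, Polynomial.coeff_one, ← mul_assoc,
          mul_comm _ (Polynomial.X ^ (j0 : ℕ)), ← Nat.cast_succ, ← Polynomial.C_eq_natCast, ← Polynomial.C_mul, mul_comm (Polynomial.X ^ (j0 : ℕ)),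
          Polynomial.coeff_C_mul, Polynomial.coeff_X_pow, if_neg hj]
        split_ifs <;> simp
      · rw [mul_mul_mul_comm, ← Polynomial.C_mul, DualNumber.eps_mul_eps, map_zero, zero_mul]
    · have h2 : ∑ j : Fin (b i), Polynomial.C (T (v i j)) * Polynomial.X ^ (j : ℕ) = 0 := by
        refine Finset.sum_eq_zero fun j _ => ?_
        rw [hT ⟨i, j⟩]
        simp [h]
      simp only [h2]
      simp
  · simp

def famSet (k : Type*) [Field k] {n s : ℕ} (b : Fin s → ℕ) (d : ℕ) : Set (MvPolynomial (Fin n) k) :=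
  {F : MvPolynomial (Fin n) k |
        ∃ v : (i : Fin s) → Fin (b i) → (Fin n → k),
          (LinearIndependent k fun p : Σ i, Fin (b i) => v p.1 p.2) ∧
          F ∈ Submodule.span k
            (⋃ i : Fin s, {G | ∃ j < b i, G = (veroneseJet (v i) d).coeff j}) ∧
          ∀ c : Fin s → ℕ, (∀ i, c i ≤ b i) → (∃ i, c i < b i) →
            F ∉ Submodule.span k
              (⋃ i : Fin s, {G | ∃ j < c i, G = (veroneseJet (v i) d).coeff j})}

theorem veroneseJet_eq {k : Type*} [Field k] {n t : ℕ} (w : Fin t → (Fin n → k)) (d : ℕ) :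
    veroneseJet w d = jetA w ^ d := rfl

theorem famSet_sub {k : Type*} [Field k] {n s : ℕ} (b : Fin s → ℕ) (d : ℕ) (F : MvPolynomial (Fin n) k)
    (hF : F ∈ famSet k b d) : ∃ v a, F = famA b d v a := by
  obtain ⟨v, -, h, -⟩ := hF
  have : (⋃ i : Fin s, {G | ∃ j < b i, G = (veroneseJet (v i) d).coeff j}) ⊆
      Set.range (fun p : Σ i, Fin (b i) => (jetA (v p.1) ^ d).coeff p.2) := by
    rintro G hG
    simp only [Set.mem_iUnion, Set.mem_ofPred_eq] at hG
    obtain ⟨i, j, hj, rfl⟩ := hG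
    exact ⟨⟨i, ⟨j, hj⟩⟩, rfl⟩
  have h2 := Submodule.span_mono this h
  obtain ⟨a, ha⟩ := (Submodule.mem_span_range_iff_exists_fun k).mp h2
  refine ⟨v, fun i j => a ⟨i, j⟩, ?_⟩
  rw [← ha, famA, Fintype.sum_sigma]
  simp only [MvPolynomial.smul_eq_C_mul]

theorem famSet_mem {k : Type*} [Field k] [CharZero k] {n s : ℕ} (b : Fin s → ℕ) (hb1 : ∀ i, 1 ≤ b i) (d : ℕ) (hd : 1 ≤ d)
    (v : (i : Fin s) → Fin (b i) → Fin n → k) (a : (i : Fin s) → Fin (b i) → k)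
    (hv : LinearIndependent k fun p : Σ i, Fin (b i) => v p.1 p.2)
    (ha : ∀ i, a i ⟨b i - 1, by have := hb1 i; omega⟩ ≠ 0) : famA b d v a ∈ famSet k b d := by
  classical
  refine ⟨v, hv, ?_, ?_⟩
  · refine Submodule.sum_mem _ fun i _ => Submodule.sum_mem _ fun j _ => ?_
    rw [← MvPolynomial.smul_eq_C_mul]
    refine Submodule.smul_mem _ _ (Submodule.subset_span ?_)
    rw [Set.mem_iUnion]
    exact ⟨i, j, j.2, rfl⟩
  · rintro c hc ⟨i0, hi0⟩ hF
    have hlast : b i0 - 1 < b i0 := by have := hb1 i0; omega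
    obtain ⟨T, hT⟩ := aux_extend _ (aux_li b hb1 d hd v hv)
      (fun p : Σ i, Fin (b i) => if p = ⟨i0, ⟨b i0 - 1, hlast⟩⟩ then (1 : k) else 0)
    have h1 : T (famA b d v a) = a i0 ⟨b i0 - 1, hlast⟩ := by
      have : famA b d v a = ∑ p : Σ i, Fin (b i), a p.1 p.2 • (jetA (v p.1) ^ d).coeff p.2 := by
        rw [famA, Fintype.sum_sigma]
        simp only [MvPolynomial.smul_eq_C_mul]
      rw [this]
      simp only [map_sum, map_smul, hT]
      simp
    have h2 : T (famA b d v a) = 0 := by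
      have : Submodule.span k (⋃ i : Fin s, {G | ∃ j < c i, G = (veroneseJet (v i) d).coeff j}) ≤ LinearMap.ker T := by
        rw [Submodule.span_le]
        intro G hG
        simp only [Set.mem_iUnion, Set.mem_ofPred_eq] at hG
        obtain ⟨i, j, hj, rfl⟩ := hG
        have h3 := hT ⟨i, ⟨j, hj.trans_le (hc i)⟩⟩
        rw [if_neg] at h3
        · exact h3
        · intro h
          have h4 : i = i0 := congrArg Sigma.fst h
          subst h4
          have h5 := congrArg Fin.val (eq_of_heq (Sigma.mk.inj h).2)
          simp only at h5
          omega
      exact this hF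
    exact ha i0 (h1.symm.trans h2)

abbrev Par {s : ℕ} (b : Fin s → ℕ) (n : ℕ) : Type := ((Σ i, Fin (b i)) × Fin n) ⊕ (Σ i, Fin (b i))

noncomputable def vgen (k : Type*) [Field k] {s : ℕ} (b : Fin s → ℕ) (n : ℕ) (i : Fin s) (j : Fin (b i)) (l : Fin n) :
    MvPolynomial (Par b n) k := X (Sum.inl (⟨i, j⟩, l))

noncomputable def agen (k : Type*) [Field k] {s : ℕ} (b : Fin s → ℕ) (n : ℕ) (i : Fin s) (j : Fin (b i)) :
    MvPolynomial (Par b n) k := X (Sum.inr ⟨i, j⟩)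

/-- specialization of the generic parameters -/
theorem PhiA_spec {k A : Type*} [Field k] [CommRing A] [Algebra k A] {n s : ℕ} (b : Fin s → ℕ) (d : ℕ)
    (v : (i : Fin s) → Fin (b i) → Fin n → A) (a : (i : Fin s) → Fin (b i) → A) :
    PhiA k b d v a = (aeval (Sum.elim (fun q => v q.1.1 q.1.2 q.2) (fun p => a p.1 p.2))).comp
      (PhiA k b d (vgen k b n) (agen k b n)) := by
  rw [← PhiA_comp]
  simp [vgen, agen]

theorem eval_fam {k : Type*} [Field k] {n s : ℕ} (b : Fin s → ℕ) (d : ℕ)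
    (v : (i : Fin s) → Fin (b i) → Fin n → k) (a : (i : Fin s) → Fin (b i) → k) (p) :
    MvPolynomial.eval (fun σ => coeff σ (famA b d v a)) p = PhiA k b d v a p := by
  rw [PhiA, MvPolynomial.aeval_eq_eval]

theorem ideal_eq {k : Type*} [Field k] [CharZero k] {n s : ℕ} (b : Fin s → ℕ) (hb1 : ∀ i, 1 ≤ b i) (d : ℕ) (hd : 1 ≤ d)
    (emb : (Σ i, Fin (b i)) ↪ Fin n) :
    vanishingIdealOfFamily (famSet k b d) = RingHom.ker (PhiA k b d (vgen k b n) (agen k b n)) := by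
  classical
  ext p
  rw [vanishingIdealOfFamily]
  simp only [Submodule.mem_iInf, RingHom.mem_ker]
  constructor
  · intro h
    set g : MvPolynomial (Par b n) k :=
      (Matrix.of fun q q' : Σ i, Fin (b i) => vgen k b n q.1 q.2 (emb q')).det * ∏ i, agen k b n i ⟨b i - 1, by have := hb1 i; omega⟩ with hg
    have hg0 : g ≠ 0 := by
      intro h0
      have h1 := congrArg (aeval (R := k) (Sum.elim (fun q : (Σ i, Fin (b i)) × Fin n => if emb q.1 = q.2 then (1 : k) else 0) (fun _ => 1))) h0
      rw [hg, map_mul, AlgHom.map_det, map_prod, map_zero] at h1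
      have h2 : (AlgHom.mapMatrix (aeval (R := k) (Sum.elim (fun q : (Σ i, Fin (b i)) × Fin n => if emb q.1 = q.2 then (1 : k) else 0) (fun _ => 1)))
        (Matrix.of fun q q' : Σ i, Fin (b i) => vgen k b n q.1 q.2 (emb q'))) = 1 := by
        ext q q'
        simp [vgen, Matrix.one_apply]
      rw [h2] at h1
      simp [agen] at h1
    have key : g * PhiA k b d (vgen k b n) (agen k b n) p = 0 := by
      apply MvPolynomial.funext
      intro x
      rw [map_mul, map_zero]
      by_cases hx : MvPolynomial.eval x g = 0
      · rw [hx, zero_mul]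
      rw [hg, map_mul] at hx
      have hx1 := left_ne_zero_of_mul hx
      have hx2 := right_ne_zero_of_mul hx
      rw [map_prod, Finset.prod_ne_zero_iff] at hx2
      set v : (i : Fin s) → Fin (b i) → Fin n → k := fun i j l => x (Sum.inl (⟨i, j⟩, l)) with hv
      set a : (i : Fin s) → Fin (b i) → k := fun i j => x (Sum.inr ⟨i, j⟩) with ha
      have hv1 : LinearIndependent k fun p : Σ i, Fin (b i) => v p.1 p.2 := by
        rw [RingHom.map_det] at hx1
        have h3 := Matrix.linearIndependent_rows_of_det_ne_zero hx1
        refine LinearIndependent.of_comp (LinearMap.funLeft k k emb) ?_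
        have h6 : (LinearMap.funLeft k k emb) ∘ (fun p : Σ i, Fin (b i) => v p.1 p.2) =
            fun q => (MvPolynomial.eval x).mapMatrix (Matrix.of fun q q' : Σ i, Fin (b i) => vgen k b n q.1 q.2 (emb q')) q := by
          funext q q'
          simp [vgen, hv, LinearMap.funLeft]
        rw [h6]
        exact h3
      have ha1 : ∀ i, a i ⟨b i - 1, by have := hb1 i; omega⟩ ≠ 0 := by
        intro i
        have := hx2 i (Finset.mem_univ _)
        simpa [agen] using this
      have h4 := h _ (famSet_mem b hb1 d hd v a hv1 ha1)
      rw [eval_fam, PhiA_spec] at h4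
      have h5 : (Sum.elim (fun q : (Σ i, Fin (b i)) × Fin n => v q.1.1 q.1.2 q.2) (fun p : Σ i, Fin (b i) => a p.1 p.2)) = x := by
        funext q
        rcases q with q | q <;> simp [hv, ha]
      rw [h5, AlgHom.comp_apply, MvPolynomial.aeval_eq_eval] at h4
      rw [show (MvPolynomial.eval x) _ = 0 from h4, mul_zero]
    exact (mul_eq_zero.mp key).resolve_left hg0
  · intro h F hF
    obtain ⟨v, a, rfl⟩ := famSet_sub b d F hF
    rw [eval_fam, PhiA_spec, AlgHom.comp_apply, h, map_zero]


theorem quot_finiteType {k P τ : Type*} [Field k] [CommRing P] [Algebra k P] (x : τ → P)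
    (hx : (Set.range x).Finite) (I : Ideal (MvPolynomial τ k)) (hI : I = RingHom.ker (aeval (R := k) x)) :
    Algebra.FiniteType k (MvPolynomial τ k ⧸ I) := by
  subst hI
  have h1 : (aeval (R := k) x).range.FG := by
    rw [← Algebra.adjoin_range_eq_range_aeval]
    exact Subalgebra.fg_def.mpr ⟨_, hx, rfl⟩
  have h2 : Algebra.FiniteType k (aeval (R := k) x).range := by
    rw [Subalgebra.fg_iff_finiteType] at h1
    exact h1
  have h3 := (Ideal.quotientEquivAlgOfEq k (AlgHom.ker_rangeRestrict (aeval (R := k) x)).symm).trans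
    (Ideal.quotientKerAlgEquivOfSurjective (AlgHom.rangeRestrict_surjective (aeval (R := k) x)))
  exact Algebra.FiniteType.equiv h2 h3.symm

theorem quot_trdeg_le.{u} {k P K : Type u} {τ : Type} {Z : Type} [Fintype Z] [Field k] [CommRing P] [IsDomain P] [Algebra k P] [Field K]
    [Algebra k K] (Φ : MvPolynomial τ k →ₐ[k] P) (ι : P →ₐ[k] K) (hι : Function.Injective ι)
    (Ψ : MvPolynomial τ k →ₐ[k] MvPolynomial Z k) (ρ : MvPolynomial Z k →ₐ[k] K)
    (h : ι.comp Φ = ρ.comp Ψ) (I : Ideal (MvPolynomial τ k)) (hI : I = RingHom.ker Φ) :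
    Algebra.trdeg k (MvPolynomial τ k ⧸ I) ≤ (Fintype.card Z : Cardinal) := by
  have hker : ∀ a, a ∈ I ↔ (ρ.comp Ψ) a = 0 := by
    intro a
    rw [hI, RingHom.mem_ker, ← h, AlgHom.comp_apply, map_eq_zero_iff _ hι]
  set f : (MvPolynomial τ k ⧸ I) →ₐ[k] ρ.range := Ideal.Quotient.liftₐ I (ρ.rangeRestrict.comp Ψ) (by
    intro a ha
    apply Subtype.ext
    exact (hker a).mp ha) with hf
  have hfi : Function.Injective f := by
    rw [injective_iff_map_eq_zero]
    intro a ha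
    obtain ⟨a, rfl⟩ := Ideal.Quotient.mk_surjective a
    rw [Ideal.Quotient.eq_zero_iff_mem, hker]
    exact congrArg Subtype.val ha
  have h1 := trdeg_le_of_injective f hfi
  have h2 := trdeg_le_of_surjective ρ.rangeRestrict (AlgHom.rangeRestrict_surjective ρ)
  have h3 : Algebra.trdeg k (MvPolynomial Z k) = Fintype.card Z := by
    rw [MvPolynomial.trdeg_of_isDomain]
    simp
  exact (h1.trans h2).trans h3.le

abbrev ZPar {s : ℕ} (b : Fin s → ℕ) (m : ℕ) : Type := Fin s ⊕ ((Σ i, Fin (b i)) × Fin m)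

theorem card_ZPar {s : ℕ} (b : Fin s → ℕ) (m : ℕ) (hb : ∑ i, b i = 5) : Fintype.card (ZPar b m) = 5 * m + s := by
  simp [hb]; ring

noncomputable def vsl (k : Type*) [Field k] {s : ℕ} (b : Fin s → ℕ) (m : ℕ) (i : Fin s) (j : Fin (b i)) :
    Fin (m + 2) → MvPolynomial (ZPar b (m + 1)) k :=
  Fin.cons (if (j : ℕ) = 0 then 1 else 0) (fun l : Fin (m + 1) => if l = 0 then
    (if (j : ℕ) = 0 then X (Sum.inl i) else if (j : ℕ) = 1 then 1 else 0) else X (Sum.inr (⟨i, j⟩, l)))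

noncomputable def asl (k : Type*) [Field k] {s : ℕ} (b : Fin s → ℕ) (m : ℕ) (i : Fin s) (j : Fin (b i)) :
    MvPolynomial (ZPar b (m + 1)) k := X (Sum.inr (⟨i, j⟩, 0))

theorem vsl_map {k K : Type*} [Field k] [Field K] [Algebra k K] {s : ℕ} (b : Fin s → ℕ) (m : ℕ)
    (c : Fin s → K) (z : (i : Fin s) → Fin (b i) → Fin (m + 1) → K) (i : Fin s) (j : Fin (b i)) (l : Fin (m + 2)) :
    aeval (Sum.elim c (fun q : (Σ i, Fin (b i)) × Fin (m + 1) => z q.1.1 q.1.2 q.2)) (vsl k b m i j l) =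
    (Fin.cons (if (j : ℕ) = 0 then 1 else 0) (fun l : Fin (m + 1) => if l = 0 then
          (if (j : ℕ) = 0 then c i else if (j : ℕ) = 1 then 1 else 0) else z i j l) : Fin (m + 2) → K) l := by
  refine Fin.cases ?_ (fun l => ?_) l
  · simp only [vsl, Fin.cons_zero]
    split_ifs <;> simp
  · simp only [vsl, Fin.cons_succ]
    split_ifs <;> simp

theorem fam_trdeg_le_aux.{u} {k K : Type u} [Field k] [Field K] [Algebra k K] {m s : ℕ} (b : Fin s → ℕ) (hb1 : ∀ i, 1 ≤ b i) (d : ℕ)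
    (ι : MvPolynomial (Par b (m + 2)) k →ₐ[k] K) (hι : Function.Injective ι) (I : Ideal (MvPolynomial (Fin (m + 2) →₀ ℕ) k))
    (hI : I = RingHom.ker (PhiA k b d (vgen k b (m + 2)) (agen k b (m + 2)))) :
    Algebra.trdeg k (MvPolynomial (Fin (m + 2) →₀ ℕ) k ⧸ I) ≤ (Fintype.card (ZPar b (m + 1)) : Cardinal) := by
  classical
  have hX : ∀ i j l, ι (vgen k b (m + 2) i j l) ≠ 0 := by
    intro i j l
    rw [Ne, map_eq_zero_iff _ hι]
    exact MvPolynomial.X_ne_zero _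
  have hsl := fun i => aux_slice (hb1 i) d (fun j l => ι (vgen k b (m + 2) i j l)) (hX _ _ _)
    (by
      intro h2 h
      rw [← map_mul, ← map_mul, ← map_sub, map_eq_zero_iff _ hι] at h
      have := congrArg (MvPolynomial.eval (Sum.elim (fun q : (Σ i, Fin (b i)) × Fin (m + 2) => if (q.1.2 : ℕ) = (q.2 : ℕ) then (1 : k) else 0)
        (fun _ => 0))) h
      simp [vgen] at this)
    (fun j => ι (agen k b (m + 2) i j))
  choose c z hcz using hsl
  refine quot_trdeg_le (PhiA k b d (vgen k b (m + 2)) (agen k b (m + 2))) ι hι (PhiA k b d (vsl k b m) (asl k b m))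
    (aeval (Sum.elim c (fun q : (Σ i, Fin (b i)) × Fin (m + 1) => z q.1.1 q.1.2 q.2))) ?_ I hI
  rw [← PhiA_comp, ← PhiA_comp]
  simp only [vsl_map]
  unfold PhiA
  refine congrArg (aeval (R := k)) (funext fun σ => congrArg (coeff σ) ?_)
  unfold famA
  refine Finset.sum_congr rfl fun i _ => (hcz i).trans ?_
  simp [asl]


theorem fam_trdeg_le.{u} {k : Type u} [Field k] {m s : ℕ} (b : Fin s → ℕ) (hb1 : ∀ i, 1 ≤ b i) (d : ℕ)
    (I : Ideal (MvPolynomial (Fin (m + 2) →₀ ℕ) k))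
    (hI : I = RingHom.ker (PhiA k b d (vgen k b (m + 2)) (agen k b (m + 2)))) :
    Algebra.trdeg k (MvPolynomial (Fin (m + 2) →₀ ℕ) k ⧸ I) ≤ (Fintype.card (ZPar b (m + 1)) : Cardinal) :=
  fam_trdeg_le_aux b hb1 d (IsScalarTower.toAlgHom k (MvPolynomial (Par b (m + 2)) k)
    (FractionRing (MvPolynomial (Par b (m + 2)) k)))
    (IsFractionRing.injective (MvPolynomial (Par b (m + 2)) k) (FractionRing (MvPolynomial (Par b (m + 2)) k))) I hI


theorem aux_trunc {k : Type*} [CommRing k] (b : ℕ) (hb : 1 ≤ b) (x V W : Polynomial k) (h : ∀ j < b, V.coeff j = x.coeff j)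
    (D : ℕ) : (V ^ D * W).coeff (b - 1) = (x ^ D * W).coeff (b - 1) := by
  have h1 : Polynomial.X ^ b ∣ V - x := by
    rw [Polynomial.X_pow_dvd_iff]
    intro j hj
    rw [Polynomial.coeff_sub, h j hj, sub_self]
  have h2 : Polynomial.X ^ b ∣ V ^ D * W - x ^ D * W := by
    rw [← sub_mul]
    exact Dvd.dvd.mul_right (h1.trans (sub_dvd_pow_sub_pow V x D)) W
  have h3 := (Polynomial.X_pow_dvd_iff.mp h2) (b - 1) (by omega)
  rwa [Polynomial.coeff_sub, sub_eq_zero] at h3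

theorem aux_four {k : Type*} [Field k] [CharZero k] (D : ℕ) (hD : 2 ≤ D) (α β γ δ : k)
    (h : ∀ r : k, α + r * β + r ^ D * (γ + r * δ) = 0) : α = 0 ∧ β = 0 := by
  have hp : Polynomial.C α + Polynomial.C β * Polynomial.X + (Polynomial.C γ + Polynomial.C δ * Polynomial.X) * Polynomial.X ^ D = 0 := by
    apply Polynomial.funext
    intro r
    simp only [Polynomial.eval_add, Polynomial.eval_mul, Polynomial.eval_C, Polynomial.eval_X, Polynomial.eval_pow, Polynomial.eval_zero]
    linear_combination h r
  have h0 := congrArg (fun p => Polynomial.coeff p 0) hp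
  have h1 := congrArg (fun p => Polynomial.coeff p 1) hp
  simp only [Polynomial.coeff_add, Polynomial.coeff_mul_X_pow', Polynomial.coeff_C_mul, Polynomial.coeff_X, Polynomial.coeff_C, Polynomial.coeff_zero] at h0 h1
  have hD0 : ¬ D ≤ 0 := by omega
  have hD1 : ¬ D ≤ 1 := by omega
  rw [if_neg hD0] at h0
  rw [if_neg hD1] at h1
  constructor
  · simpa using h0
  · simpa using h1

/-- the linear map `x ↦ ∑ j, (c j · x) t^j` -/
noncomputable def Wl {k : Type*} [Field k] {n b : ℕ} (c : Fin b → Fin n → k) : (Fin n → k) →ₗ[k] Polynomial k :=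
  ∑ j : Fin b, (Polynomial.monomial (j : ℕ)).comp (∑ l, c j l • LinearMap.proj l)

theorem Wl_coeff {k : Type*} [Field k] {n b : ℕ} (c : Fin b → Fin n → k) (x : Fin n → k) (j : Fin b) :
    (Wl c x).coeff j = ∑ l, c j l * x l := by
  simp only [Wl, LinearMap.sum_apply, LinearMap.comp_apply, Polynomial.finsetSum_coeff, Polynomial.coeff_monomial]
  rw [Finset.sum_eq_single j]
  · simp
  · intro j' _ hj'
    rw [if_neg]
    exact fun h => hj' (Fin.ext h)
  · simp

theorem Wl_coeff_ge {k : Type*} [Field k] {n b : ℕ} (c : Fin b → Fin n → k) (x : Fin n → k) (j : ℕ) (hj : b ≤ j) :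
    (Wl c x).coeff j = 0 := by
  simp only [Wl, LinearMap.sum_apply, LinearMap.comp_apply, Polynomial.finsetSum_coeff, Polynomial.coeff_monomial]
  refine Finset.sum_eq_zero fun j' _ => ?_
  rw [if_neg]
  have := j'.2
  omega

theorem Wl_single {k : Type*} [Field k] {n b : ℕ} (c : Fin b → Fin n → k) (l : Fin n) (j : Fin b) :
    (Wl c (Pi.single l 1)).coeff j = c j l := by
  rw [Wl_coeff]
  simp [Pi.single_apply]

/-- insertion of polynomial coefficients in a block -/
noncomputable def yblk {k : Type*} [Field k] {n b : ℕ} (e : Fin b → Fin n) : Polynomial k →ₗ[k] (Fin n → k) :=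
  ∑ j : Fin b, (LinearMap.single k (fun _ => k) (e j)).comp (Polynomial.lcoeff k (j : ℕ))

theorem yblk_apply {k : Type*} [Field k] {n b : ℕ} (e : Fin b → Fin n) (p : Polynomial k) :
    yblk e p = ∑ j : Fin b, Pi.single (e j) (p.coeff j) := by
  simp [yblk]

theorem yblk_in {k : Type*} [Field k] {n b : ℕ} (e : Fin b → Fin n) (he : Function.Injective e) (p : Polynomial k) (j : Fin b) :
    yblk e p (e j) = p.coeff j := by
  rw [yblk_apply, Finset.sum_apply, Finset.sum_eq_single j]
  · simp
  · intro j' _ hj'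
    rw [Pi.single_apply, if_neg]
    exact fun h => hj' (he h).symm
  · simp

theorem yblk_out {k : Type*} [Field k] {n b : ℕ} (e : Fin b → Fin n) (p : Polynomial k) (l : Fin n) (hl : ∀ j, e j ≠ l) :
    yblk e p l = 0 := by
  rw [yblk_apply, Finset.sum_apply]
  refine Finset.sum_eq_zero fun j _ => ?_
  rw [Pi.single_apply, if_neg]
  exact fun h => hl j h.symm

theorem yblk_X {k : Type*} [Field k] {n b : ℕ} (e : Fin b → Fin n) (j : Fin b) :
    yblk e (Polynomial.X ^ (j : ℕ) : Polynomial k) = Pi.single (e j) 1 := by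
  rw [yblk_apply, Finset.sum_eq_single j]
  · simp
  · intro j' _ hj'
    rw [Polynomial.coeff_X_pow, if_neg]
    · simp
    · exact fun h => hj' (Fin.ext h)
  · simp

theorem aux_sep {k : Type*} [Field k] [CharZero k] {n s : ℕ} (b : Fin s → ℕ) (hb1 : ∀ i, 1 ≤ b i) (D : ℕ) (hD : 2 ≤ D)
    (emb : (Σ i, Fin (b i)) ↪ Fin n) (cc : (i : Fin s) → Fin (b i) → Fin n → k)
    (hcc : ∀ i (j : Fin (b i)), (j : ℕ) + 1 ≠ b i → cc i j (emb ⟨i, ⟨0, hb1 i⟩⟩) = 0)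
    (h : ∀ x : Fin n → k, ∑ i, ((Wl (fun j => Pi.single (emb ⟨i, j⟩) 1) x) ^ D * Wl (cc i) x).coeff (b i - 1) = 0)
    (i : Fin s) (j : Fin (b i)) (l : Fin n) : cc i j l = 0 := by
  classical
  set V : (i : Fin s) → (Fin n → k) →ₗ[k] Polynomial k := fun i => Wl (fun j => Pi.single (emb ⟨i, j⟩) 1) with hV
  have hVc : ∀ i x (j : Fin (b i)), (V i x).coeff j = x (emb ⟨i, j⟩) := by
    intro i x j
    rw [hV, Wl_coeff]
    simp [Pi.single_apply]
  have hV0 : ∀ i x, (∀ j, x (emb ⟨i, j⟩) = 0) → V i x = 0 := by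
    intro i x hx
    ext j
    rw [Polynomial.coeff_zero]
    by_cases hj : j < b i
    · exact (hVc i x ⟨j, hj⟩).trans (hx _)
    · exact Wl_coeff_ge _ _ _ (by omega)
  have two : ∀ i y z, (∀ i', i' ≠ i → V i' y = 0) → V i z = 0 →
      ((V i y) ^ D * Wl (cc i) y).coeff (b i - 1) = 0 ∧ ((V i y) ^ D * Wl (cc i) z).coeff (b i - 1) = 0 := by
    intro i y z hy hz
    apply aux_four D hD _ _ (∑ i' ∈ Finset.univ.erase i, ((V i' z) ^ D * Wl (cc i') y).coeff (b i' - 1))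
      (∑ i' ∈ Finset.univ.erase i, ((V i' z) ^ D * Wl (cc i') z).coeff (b i' - 1))
    intro r
    have h1 := h (y + r • z)
    rw [← Finset.add_sum_erase _ _ (Finset.mem_univ i)] at h1
    rw [← h1]
    congr 1
    · change _ = ((V i (y + r • z)) ^ D * _).coeff _
      rw [map_add, map_smul, hz, smul_zero, add_zero, map_add, map_smul, mul_add, Polynomial.coeff_add, mul_smul_comm,
        Polynomial.coeff_smul, smul_eq_mul]
    · rw [Finset.mul_sum, ← Finset.sum_add_distrib, Finset.mul_sum]
      refine Finset.sum_congr rfl fun i' hi' => ?_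
      have hi'' := Finset.ne_of_mem_erase hi'
      change _ = ((V i' (y + r • z)) ^ D * _).coeff _
      rw [map_add, map_smul, hy i' hi'', zero_add, map_add, map_smul, smul_pow, smul_mul_assoc,
        Polynomial.coeff_smul, mul_add ((V i') z ^ D), Polynomial.coeff_add, mul_smul_comm r, Polynomial.coeff_smul, smul_eq_mul, smul_eq_mul]
  set e : Fin (b i) → Fin n := fun j => emb ⟨i, j⟩ with he
  have hei : Function.Injective e := by
    intro j j' hjj
    exact eq_of_heq (Sigma.mk.inj (emb.injective hjj)).2
  have hyV : ∀ ξ : Polynomial k, ∀ i', i' ≠ i → V i' (yblk e ξ) = 0 := by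
    intro ξ i' hi'
    refine hV0 _ _ fun j' => yblk_out _ _ _ fun j hj => ?_
    exact hi' (congrArg Sigma.fst (emb.injective hj)).symm
  have hyV2 : ∀ ξ : Polynomial k, ∀ j < b i, (V i (yblk e ξ)).coeff j = ξ.coeff j := by
    intro ξ j hj
    exact (hVc i _ ⟨j, hj⟩).trans (yblk_in e hei ξ ⟨j, hj⟩)
  by_cases hl : ∃ j', e j' = l
  · obtain ⟨j', rfl⟩ := hl
    have := aux_tangent (b i) D hD ((Wl (cc i)).comp (yblk e)) (fun x j hj => Wl_coeff_ge _ _ _ hj) (by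
      intro j hj
      by_cases hjb : j < b i
      · have hx := yblk_X (k := k) e ⟨0, hb1 i⟩
        simp only [pow_zero] at hx
        rw [LinearMap.comp_apply, hx]
        refine (Wl_single (cc i) _ ⟨j, hjb⟩).trans (hcc i _ ?_)
        simp only
        omega
      · exact Wl_coeff_ge _ _ _ (by omega)) (by
      intro x
      have h1 := (two i (yblk e x) 0 (hyV x) (map_zero _)).1
      rwa [aux_trunc (b i) (hb1 i) x _ _ (hyV2 x)] at h1) (j' : ℕ)
    rw [LinearMap.comp_apply, yblk_X] at this
    rw [← Wl_single (cc i) (e j') j, this, Polynomial.coeff_zero]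
  · have hz : V i (Pi.single l 1) = 0 := by
      refine hV0 _ _ fun j' => ?_
      rw [Pi.single_apply, if_neg]
      exact fun h => hl ⟨j', h⟩
    have hξ : ∀ x : Polynomial k, (x ^ D * Wl (cc i) (Pi.single l 1)).coeff (b i - 1) = 0 := by
      intro x
      have h1 := (two i (yblk e x) _ (hyV x) hz).2
      rwa [aux_trunc (b i) (hb1 i) x _ _ (hyV2 x)] at h1
    rw [← Wl_single (cc i) l j]
    refine aux_nondeg (b i) _ (fun x => ?_) j j.2
    have := aux_expand (b i - 1) D x (Wl (cc i) (Pi.single l 1)) (fun u => by rw [hξ, mul_zero]) 1 (by omega)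
    rwa [pow_one] at this


theorem dual_deriv {k Z : Type*} [Field k] [Fintype Z] (c : Z → k) (f : MvPolynomial Z k) :
    TrivSqZeroExt.fst (aeval (fun q => (TrivSqZeroExt.inr (c q) : DualNumber k)) f) = MvPolynomial.eval 0 f ∧
    TrivSqZeroExt.snd (aeval (fun q => (TrivSqZeroExt.inr (c q) : DualNumber k)) f) =
      ∑ q, c q * MvPolynomial.eval 0 (pderiv q f) := by
  classical
  induction f using MvPolynomial.induction_on with
  | C a =>
    rw [aeval_C]
    simp [TrivSqZeroExt.algebraMap_eq_inl]
  | add p q hp hq =>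
    simp only [map_add, TrivSqZeroExt.fst_add, TrivSqZeroExt.snd_add, hp.1, hq.1, hp.2, hq.2, mul_add, Finset.sum_add_distrib, and_self]
  | mul_X p i hp =>
    rw [map_mul, aeval_X, TrivSqZeroExt.fst_mul, TrivSqZeroExt.snd_mul, hp.1, hp.2]
    constructor
    · simp
    · simp only [TrivSqZeroExt.snd_inr, TrivSqZeroExt.fst_inr, pderiv_mul, map_add, map_mul, eval_X, Pi.zero_apply, mul_zero, zero_add, pderiv_X,
        MulOpposite.op_zero, zero_smul, add_zero, smul_eq_mul]
      rw [Finset.sum_eq_single i]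
      · simp [mul_comm]
      · intro q _ hq
        simp [hq.symm]
      · simp

theorem dual_eval {k : Type*} [Field k] {n : ℕ} (F : MvPolynomial (Fin n) (DualNumber k))
    (hF : ∀ σ, TrivSqZeroExt.snd (coeff σ F) = 0) (x : Fin n → k) :
    TrivSqZeroExt.snd (MvPolynomial.eval (fun l => (TrivSqZeroExt.inl (x l) : DualNumber k)) F) = 0 := by
  rw [MvPolynomial.eval_eq', TrivSqZeroExt.snd_sum]
  refine Finset.sum_eq_zero fun σ _ => ?_
  have : ∏ i, (TrivSqZeroExt.inl (x i) : DualNumber k) ^ σ i = TrivSqZeroExt.inl (∏ i, x i ^ σ i) := by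
    have := map_prod (TrivSqZeroExt.inlHom k k) (fun i => x i ^ σ i) Finset.univ
    simp only [map_pow] at this
    exact this.symm
  rw [this, TrivSqZeroExt.snd_mul, hF]
  simp

theorem fam_eval {A : Type*} [CommRing A] {n s : ℕ} (b : Fin s → ℕ) (d : ℕ)
    (v : (i : Fin s) → Fin (b i) → Fin n → A) (a : (i : Fin s) → Fin (b i) → A) (x : Fin n → A) :
    MvPolynomial.eval x (famA b d v a) = ∑ i, ∑ j : Fin (b i), a i j *
      ((∑ j : Fin (b i), Polynomial.C (∑ l, v i j l * x l) * Polynomial.X ^ (j : ℕ)) ^ d).coeff j := by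
  simp only [famA, map_sum (MvPolynomial.eval x), map_mul (MvPolynomial.eval x), eval_C]
  refine Finset.sum_congr rfl fun i _ => Finset.sum_congr rfl fun j _ => ?_
  rw [← Polynomial.coeff_map, Polynomial.map_pow, jetA, Polynomial.map_sum]
  simp only [Polynomial.map_mul, Polynomial.map_C, Polynomial.map_pow, Polynomial.map_X, linA, map_sum (MvPolynomial.eval x),
    map_mul (MvPolynomial.eval x), eval_C, eval_X]

theorem dual_jet_gen {k R : Type*} [CommRing k] [CommRing R] (φ : k →+* R) (ε : R) (hε : ε * ε = 0) (V W : Polynomial k) (D B : ℕ) :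
    ((V.map φ + Polynomial.C ε * W.map φ) ^ (D + 1)).coeff B
      = φ ((V ^ (D + 1)).coeff B) + ε * φ (((D : k) + 1) * (V ^ D * W).coeff B) := by
  rw [aux_dual_pow]
  · have : ((V.map φ) ^ (D + 1) + ((D : Polynomial R) + 1) * ((V.map φ) ^ D * (Polynomial.C ε * W.map φ))) =
        (V ^ (D + 1)).map φ + Polynomial.C ε * ((((D : Polynomial k) + 1) * (V ^ D * W)).map φ) := by
      simp only [Polynomial.map_pow, Polynomial.map_mul, Polynomial.map_add, Polynomial.map_natCast, Polynomial.map_one]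
      ring
    rw [this, Polynomial.coeff_add, Polynomial.coeff_C_mul, Polynomial.coeff_map, Polynomial.coeff_map,
      ← Nat.cast_succ, ← Polynomial.C_eq_natCast, Polynomial.coeff_C_mul, Nat.cast_succ]
  · rw [mul_mul_mul_comm, ← Polynomial.C_mul, hε, map_zero, zero_mul]

theorem dual_jet {k : Type*} [Field k] (V W : Polynomial k) (D B : ℕ) :
    TrivSqZeroExt.snd (((V.map (algebraMap k (DualNumber k)) + Polynomial.C (DualNumber.eps : DualNumber k) * W.map (algebraMap k (DualNumber k))) ^ (D + 1)).coeff B)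
      = ((D : k) + 1) * (V ^ D * W).coeff B := by
  refine (congrArg TrivSqZeroExt.snd (dual_jet_gen (algebraMap k (DualNumber k)) DualNumber.eps DualNumber.eps_mul_eps V W D B)).trans ?_
  rw [TrivSqZeroExt.snd_add, TrivSqZeroExt.snd_mul, TrivSqZeroExt.algebraMap_eq_inl]
  simp

noncomputable def vlo (k : Type*) [Field k] {m s : ℕ} (b : Fin s → ℕ) (hb1 : ∀ i, 1 ≤ b i)
    (emb : (Σ i, Fin (b i)) ↪ Fin (m + 1)) (i : Fin s) (j : Fin (b i)) (l : Fin (m + 1)) : MvPolynomial (ZPar b m) k :=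
  C (Pi.single (M := fun _ => k) (emb ⟨i, j⟩) 1 l) +
    (Fin.insertNth (emb ⟨i, ⟨0, hb1 i⟩⟩) (if (j : ℕ) + 1 = b i then X (Sum.inl i) else 0)
      (fun l' => X (Sum.inr (⟨i, j⟩, l'))) : Fin (m + 1) → MvPolynomial (ZPar b m) k) l

noncomputable def alo (k : Type*) [Field k] {s : ℕ} (b : Fin s → ℕ) (m : ℕ) (i : Fin s) (j : Fin (b i)) : MvPolynomial (ZPar b m) k :=
  if (j : ℕ) + 1 = b i then 1 else 0

def clo {k : Type*} [Field k] {m s : ℕ} (b : Fin s → ℕ) (hb1 : ∀ i, 1 ≤ b i)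
    (emb : (Σ i, Fin (b i)) ↪ Fin (m + 1)) (c : ZPar b m → k) (i : Fin s) (j : Fin (b i)) : Fin (m + 1) → k :=
  Fin.insertNth (emb ⟨i, ⟨0, hb1 i⟩⟩) (if (j : ℕ) + 1 = b i then c (Sum.inl i) else 0)
      (fun l' => c (Sum.inr (⟨i, j⟩, l')))

theorem vlo_map {k : Type*} [Field k] {m s : ℕ} (b : Fin s → ℕ) (hb1 : ∀ i, 1 ≤ b i)
    (emb : (Σ i, Fin (b i)) ↪ Fin (m + 1)) (c : ZPar b m → k) (i : Fin s) (j : Fin (b i)) (l : Fin (m + 1)) :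
    aeval (fun q => (TrivSqZeroExt.inr (c q) : DualNumber k)) (vlo k b hb1 emb i j l) =
      TrivSqZeroExt.inl (Pi.single (M := fun _ => k) (emb ⟨i, j⟩) 1 l) + DualNumber.eps * TrivSqZeroExt.inl (clo b hb1 emb c i j l) := by
  rw [vlo, map_add, aeval_C, TrivSqZeroExt.algebraMap_eq_inl]
  congr 1
  have h : ∀ x : k, (DualNumber.eps * TrivSqZeroExt.inl x : DualNumber k) = TrivSqZeroExt.inr x := by
    intro x
    ext <;> simp
  rw [h]
  refine Fin.succAboveCases (emb ⟨i, ⟨0, hb1 i⟩⟩) ?_ (fun l' => ?_) l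
  · simp only [Fin.insertNth_apply_same, clo]
    split_ifs <;> simp
  · simp only [Fin.insertNth_apply_succAbove, clo, aeval_X]

theorem tangent_inj {k : Type*} [Field k] [CharZero k] {m s : ℕ} (b : Fin s → ℕ) (hb1 : ∀ i, 1 ≤ b i)
    (emb : (Σ i, Fin (b i)) ↪ Fin (m + 1)) (D : ℕ) (hD : 2 ≤ D) (c : ZPar b m → k)
    (h : ∀ σ, ∑ q, c q * MvPolynomial.eval 0 (pderiv q (coeff σ (famA b (D + 1) (vlo k b hb1 emb) (alo k b m)))) = 0) : c = 0 := by
  classical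
  have key : ∀ x : Fin (m + 1) → k, ∑ i, ((Wl (fun j => Pi.single (emb ⟨i, j⟩) 1) x) ^ D * Wl (clo b hb1 emb c i) x).coeff (b i - 1) = 0 := by
    intro x
    set τ : MvPolynomial (ZPar b m) k →ₐ[k] DualNumber k := aeval (fun q => (TrivSqZeroExt.inr (c q) : DualNumber k)) with hτ
    have h1 := dual_eval (MvPolynomial.map (τ : MvPolynomial (ZPar b m) k →+* DualNumber k) (famA b (D + 1) (vlo k b hb1 emb) (alo k b m)))
      (fun σ => by rw [coeff_map]; exact (dual_deriv c _).2.trans (h σ)) x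
    rw [famA_map, fam_eval, TrivSqZeroExt.snd_sum] at h1
    have h2 : ∀ i, TrivSqZeroExt.snd (∑ j : Fin (b i), τ (alo k b m i j) *
      ((∑ j : Fin (b i), Polynomial.C (∑ l, τ (vlo k b hb1 emb i j l) * TrivSqZeroExt.inl (x l)) * Polynomial.X ^ (j : ℕ)) ^ (D + 1)).coeff j) =
      ((D : k) + 1) * ((Wl (fun j => Pi.single (emb ⟨i, j⟩) 1) x) ^ D * Wl (clo b hb1 emb c i) x).coeff (b i - 1) := by
      intro i
      rw [← dual_jet, Finset.sum_eq_single ⟨b i - 1, by have := hb1 i; omega⟩]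
      · have h3 : τ (alo k b m i ⟨b i - 1, by have := hb1 i; omega⟩) = 1 := by
          rw [alo, if_pos, map_one]
          have := hb1 i
          simp only
          omega
        rw [h3, one_mul]
        congr 3
        ext1 j
        rw [Polynomial.coeff_add, Polynomial.coeff_C_mul, Polynomial.coeff_map, Polynomial.coeff_map]
        simp only [Polynomial.finsetSum_coeff, Polynomial.coeff_C_mul, Polynomial.coeff_X_pow]
        by_cases hj : j < b i
        · rw [Finset.sum_eq_single ⟨j, hj⟩]
          · have h4 := Wl_coeff (fun j => Pi.single (M := fun _ => k) (emb ⟨i, j⟩) 1) x ⟨j, hj⟩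
            have h5 := Wl_coeff (clo b hb1 emb c i) x ⟨j, hj⟩
            simp only at h4 h5
            rw [h4, h5, if_pos rfl, mul_one, map_sum, map_sum, Finset.mul_sum, ← Finset.sum_add_distrib]
            refine Finset.sum_congr rfl fun l _ => ?_
            rw [hτ, vlo_map, map_mul, map_mul]
            simp only [TrivSqZeroExt.algebraMap_eq_inl]
            ring
          · intro j' _ hj'
            rw [if_neg, mul_zero]
            exact fun hh => hj' (Fin.ext hh.symm)
          · simp
        · rw [Wl_coeff_ge _ _ _ (by omega), Wl_coeff_ge _ _ _ (by omega), map_zero, mul_zero, add_zero]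
          refine Finset.sum_eq_zero fun j' _ => ?_
          rw [if_neg, mul_zero]
          have := j'.2
          omega
      · intro j _ hj
        rw [alo, if_neg, map_zero, zero_mul]
        intro hh
        apply hj
        apply Fin.ext
        simp only
        omega
      · simp
    have h3 : ((D : k) + 1) * ∑ i, ((Wl (fun j => Pi.single (emb ⟨i, j⟩) 1) x) ^ D * Wl (clo b hb1 emb c i) x).coeff (b i - 1) = 0 := by
      rw [Finset.mul_sum, ← h1]
      exact Finset.sum_congr rfl fun i _ => (h2 i).symm
    exact (mul_eq_zero.mp h3).resolve_left (Nat.cast_add_one_ne_zero D)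
  have hc := aux_sep b hb1 D hD emb (clo b hb1 emb c) (by
    intro i j hj
    rw [clo, Fin.insertNth_apply_same, if_neg hj]) key
  funext q
  rcases q with i | ⟨⟨i, j⟩, l⟩
  · have := hc i ⟨b i - 1, by have := hb1 i; omega⟩ (emb ⟨i, ⟨0, hb1 i⟩⟩)
    rw [clo, Fin.insertNth_apply_same, if_pos] at this
    · exact this
    · have := hb1 i
      simp only
      omega
  · have := hc i j ((emb ⟨i, ⟨0, hb1 i⟩⟩).succAbove l)
    rw [clo, Fin.insertNth_apply_succAbove] at this
    exact this


theorem span_alg {k τ Z : Type*} [Field k] [CharZero k] [Fintype Z] (f : τ → MvPolynomial Z k)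
    (h : ∀ c : Z → k, (∀ σ, ∑ q, c q * MvPolynomial.eval 0 (pderiv q (f σ)) = 0) → c = 0) :
    ∃ e : Z → τ, AlgebraicIndependent k (fun q => f (e q)) := by
  classical
  set r : τ → (Z → k) := fun σ q => MvPolynomial.eval 0 (pderiv q (f σ)) with hr
  have hspan : Submodule.span k (Set.range r) = ⊤ := by
    by_contra hne
    obtain ⟨φ, hφ, hle⟩ := Submodule.exists_le_ker_of_lt_top _ (lt_top_iff_ne_top.mpr hne)
    have hφ2 : ∀ x : Z → k, φ x = ∑ q, φ (Pi.single q 1) * x q := by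
      intro x
      rw [LinearMap.pi_apply_eq_sum_univ φ x]
      refine Finset.sum_congr rfl fun q _ => ?_
      rw [smul_eq_mul, mul_comm]
      congr 2
      funext i
      simp [Pi.single_apply, eq_comm]
    have hc := h (fun q => φ (Pi.single q 1)) (fun σ => by
      have h1 : φ (r σ) = 0 := hle (Submodule.subset_span ⟨σ, rfl⟩)
      rw [hφ2] at h1
      exact h1)
    apply hφ
    apply LinearMap.ext
    intro x
    rw [hφ2]
    refine Finset.sum_eq_zero fun q _ => ?_
    rw [show φ (Pi.single q 1) = 0 from congrFun hc q, zero_mul]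
  obtain ⟨κ, a, -, ha2, ha3⟩ := exists_linearIndependent' k r
  let B := Module.Basis.mk ha3 (by rw [ha2, hspan])
  let E := (Pi.basisFun k Z).indexEquiv B
  refine ⟨fun q => a (E q), aux_jacobian _ id ?_⟩
  have hli : LinearIndependent k (fun q => r (a (E q))) := ha3.comp E E.injective
  intro hdet
  have h1 := congrArg (MvPolynomial.eval (0 : Z → k)) hdet
  rw [RingHom.map_det, map_zero] at h1
  have h2 : IsUnit (Matrix.of fun q => r (a (E q))) := by
    rw [← Matrix.linearIndependent_rows_iff_isUnit]
    exact hli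
  rw [Matrix.isUnit_iff_isUnit_det, isUnit_iff_ne_zero] at h2
  apply h2
  rw [← h1]
  congr 1

theorem fam_trdeg_ge.{u} {k : Type u} [Field k] [CharZero k] {m s : ℕ} (b : Fin s → ℕ) (hb1 : ∀ i, 1 ≤ b i)
    (emb : (Σ i, Fin (b i)) ↪ Fin (m + 1)) (D : ℕ) (hD : 2 ≤ D)
    (I : Ideal (MvPolynomial (Fin (m + 1) →₀ ℕ) k))
    (hI : I = RingHom.ker (PhiA k b (D + 1) (vgen k b (m + 1)) (agen k b (m + 1)))) :
    (Fintype.card (ZPar b m) : Cardinal) ≤ Algebra.trdeg k (MvPolynomial (Fin (m + 1) →₀ ℕ) k ⧸ I) := by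
  obtain ⟨e, he⟩ := span_alg _ (tangent_inj b hb1 emb D hD (k := k))
  let f : (MvPolynomial (Fin (m + 1) →₀ ℕ) k ⧸ I) →ₐ[k] MvPolynomial (ZPar b m) k :=
    Ideal.Quotient.liftₐ I (PhiA k b (D + 1) (vlo k b hb1 emb) (alo k b m)) (by
      intro a ha
      rw [hI, RingHom.mem_ker] at ha
      rw [PhiA_spec, AlgHom.comp_apply, ha, map_zero])
  have h1 : AlgebraicIndependent k (fun q => (Ideal.Quotient.mkₐ k I (X (e q)))) := by
    refine AlgebraicIndependent.of_comp f ?_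
    convert he using 2 with q
    exact aeval_X (R := k) _ _
  have := h1.lift_cardinalMk_le_trdeg
  rw [Cardinal.mk_fintype, Cardinal.lift_natCast, Cardinal.lift_id'] at this
  exact this


theorem fam_main.{u} {k : Type u} [Field k] [CharZero k] (m d s : ℕ) (hm : 4 ≤ m) (hd : 9 ≤ d)
    (b : Fin s → ℕ) (hb1 : ∀ i, 1 ≤ b i) (hbsum : ∑ i, b i = 5)
    (I : Ideal (MvPolynomial (Fin (m + 1) →₀ ℕ) k)) (hI0 : I = vanishingIdealOfFamily (famSet k b d)) :
    I.IsPrime ∧ ringKrullDim (MvPolynomial (Fin (m + 1) →₀ ℕ) k ⧸ I) = (5 * m + s : ℕ) := by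
  obtain ⟨emb⟩ : Nonempty ((Σ i, Fin (b i)) ↪ Fin (m + 1)) := by
    apply Function.Embedding.nonempty_of_card_le
    simp [hbsum]
    omega
  have hI : I = RingHom.ker (PhiA k b d (vgen k b (m + 1)) (agen k b (m + 1))) :=
    hI0.trans (ideal_eq b hb1 d (by omega) emb)
  have hp : I.IsPrime := by
    rw [hI]
    exact RingHom.ker_isPrime _
  refine ⟨hp, ?_⟩
  have hfin : Algebra.FiniteType k (MvPolynomial (Fin (m + 1) →₀ ℕ) k ⧸ I) := by
    refine quot_finiteType _ ?_ I hI
    classical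
    set F := famA b d (vgen k b (m + 1)) (agen k b (m + 1))
    refine Set.Finite.subset ((F.support.finite_toSet.image (fun σ => coeff σ F)).insert 0) ?_
    rintro _ ⟨σ, rfl⟩
    by_cases h : σ ∈ F.support
    · exact Or.inr ⟨σ, h, rfl⟩
    · exact Or.inl (notMem_support_iff.mp h)
  apply aux_krull_trdeg (k := k)
  apply le_antisymm
  · rw [← card_ZPar b m hbsum]
    obtain ⟨m, rfl⟩ : ∃ m', m = m' + 1 := ⟨m - 1, by omega⟩
    exact fam_trdeg_le b hb1 d I hI
  · rw [← card_ZPar b m hbsum]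
    obtain ⟨D, rfl⟩ : ∃ D, d = D + 1 := ⟨d - 1, by omega⟩
    exact fam_trdeg_ge b hb1 emb D (by omega) I hI

/-- (Proposition 5.)  For `m ≥ 4` and `d ≥ 9`, the family of points of border rank `5` in
`ℙ^r` (`r = C(m+d, m) - 1`) whose unique evincing degree-`5` scheme is curvilinear of
combinatorial type `(s; b₁, …, b_s)` is irreducible of dimension `5m + s - 1`.
Encoding: the family is the cone `S` of all degree-`d` forms `F` arising from a curvilinear
scheme `A` of type `(s; b₁, …, b_s)` (components parametrized by branches, linearly
independent jets) with `F ∈ ⟨ν_d(A)⟩` and `F ∉ ⟨ν_d(A')⟩` for all proper subschemes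
`A' ⊊ A`; irreducibility means that the vanishing ideal of `S` is prime, and the dimension
statement is that the coordinate ring of the Zariski closure of the affine cone `S` has
Krull dimension `5m + s` (the cone over a projective family of dimension `5m + s - 1`). -/
theorem stmt19 (k : Type*) [Field k] [IsAlgClosed k] [CharZero k] (m d s : ℕ)
    (hm : 4 ≤ m) (hd : 9 ≤ d) (hs1 : 1 ≤ s) (hs5 : s ≤ 5)
    (b : Fin s → ℕ) (hb1 : ∀ i, 1 ≤ b i) (hbsum : ∑ i, b i = 5) :
    (vanishingIdealOfFamily
      {F : MvPolynomial (Fin (m + 1)) k |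
        ∃ v : (i : Fin s) → Fin (b i) → (Fin (m + 1) → k),
          (LinearIndependent k fun p : Σ i, Fin (b i) => v p.1 p.2) ∧
          F ∈ Submodule.span k
            (⋃ i : Fin s, {G | ∃ j < b i, G = (veroneseJet (v i) d).coeff j}) ∧
          ∀ c : Fin s → ℕ, (∀ i, c i ≤ b i) → (∃ i, c i < b i) →
            F ∉ Submodule.span k
              (⋃ i : Fin s, {G | ∃ j < c i, G = (veroneseJet (v i) d).coeff j})}).IsPrime ∧
    ringKrullDim
      (MvPolynomial ((Fin (m + 1)) →₀ ℕ) k ⧸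
        vanishingIdealOfFamily
          {F : MvPolynomial (Fin (m + 1)) k |
            ∃ v : (i : Fin s) → Fin (b i) → (Fin (m + 1) → k),
              (LinearIndependent k fun p : Σ i, Fin (b i) => v p.1 p.2) ∧
              F ∈ Submodule.span k
                (⋃ i : Fin s, {G | ∃ j < b i, G = (veroneseJet (v i) d).coeff j}) ∧
              ∀ c : Fin s → ℕ, (∀ i, c i ≤ b i) → (∃ i, c i < b i) →
                F ∉ Submodule.span k
                  (⋃ i : Fin s, {G | ∃ j < c i, G = (veroneseJet (v i) d).coeff j})}) =
      (5 * m + s : ℕ) := by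
  exact fam_main m d s hm hd b hb1 hbsum _ rfl
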